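/- Suppose the top outcome fully reveals High quality: p_L(s_m) = 0 and p_H(s_m) > 0. For each n ≥ 1 let σ̂_n be a most selective n-equilibrium strategy and Π_n = Π^n(σ̂_n) the corresponding total surplus. Then the sequence (Π_n) is eventually weakly increasing (there exists N such that Π_n ≤ Π_{n+1} for all n ≥ N) and converges to the full-information benchmark ρ·(1 − c). -/

import Mathlib

open Finset Filter Topology

noncomputable section

/-- Probability that a single buyer rejects the seller, given conditional signal
distribution `p` and strategy `σ`: `r_θ(σ) = 1 - Σ_s p_θ(s)·σ(s)`. -/
def rej {m : ℕ} (p σ : Fin m → ℝ) : ℝ := 1 - ∑ s, p s * σ s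

/-- `ν_θ(σ) = (1/n)·Σ_{k=0}^{n-1} r_θ(σ)^k`: probability of being visited. -/
def visit (n : ℕ) {m : ℕ} (p σ : Fin m → ℝ) : ℝ :=
  (1 / (n : ℝ)) * ∑ k ∈ Finset.range n, rej p σ ^ k

/-- Interim belief `Ψ(σ) = ρ·ν_H(σ) / (ρ·ν_H(σ) + (1-ρ)·ν_L(σ))`. -/
def interim (ρ : ℝ) (n : ℕ) {m : ℕ} (pL pH σ : Fin m → ℝ) : ℝ :=
  ρ * visit n pH σ / (ρ * visit n pH σ + (1 - ρ) * visit n pL σ)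

/-- Posterior belief `Q_ψ(s) = ψ·p_H(s) / (ψ·p_H(s) + (1-ψ)·p_L(s))`. -/
def post {m : ℕ} (ψ : ℝ) (pL pH : Fin m → ℝ) (s : Fin m) : ℝ :=
  ψ * pH s / (ψ * pH s + (1 - ψ) * pL s)

/-- A strategy maps each signal to an acceptance probability in `[0,1]`. -/
def IsStrategy {m : ℕ} (σ : Fin m → ℝ) : Prop := ∀ s, 0 ≤ σ s ∧ σ s ≤ 1

/-- `σ` is an equilibrium strategy: with `ψ* = Ψ(σ)`, accept for sure when the
posterior exceeds `c`, reject for sure when it falls below `c`. -/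
def IsEquilibrium (ρ c : ℝ) (n : ℕ) {m : ℕ} (pL pH σ : Fin m → ℝ) : Prop :=
  IsStrategy σ ∧
  ∀ s : Fin m,
    (c < post (interim ρ n pL pH σ) pL pH s → σ s = 1) ∧
    (post (interim ρ n pL pH σ) pL pH s < c → σ s = 0)

/-- Total surplus `Π(σ) = (1-c)·ρ·(1-r_H(σ)^n) - c·(1-ρ)·(1-r_L(σ)^n)`. -/
def surplus (ρ c : ℝ) (n : ℕ) {m : ℕ} (pL pH σ : Fin m → ℝ) : ℝ :=
  (1 - c) * ρ * (1 - rej pH σ ^ n) - c * (1 - ρ) * (1 - rej pL σ ^ n)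

/-- The most selective equilibrium strategy. -/
def MostSelective (ρ c : ℝ) (n : ℕ) {m : ℕ} (pL pH σ : Fin m → ℝ) : Prop :=
  IsEquilibrium ρ c n pL pH σ ∧
  ∀ σ' : Fin m → ℝ, IsEquilibrium ρ c n pL pH σ' → ∀ s, σ s ≤ σ' s

/-- The least selective equilibrium strategy. -/
def LeastSelective (ρ c : ℝ) (n : ℕ) {m : ℕ} (pL pH σ : Fin m → ℝ) : Prop :=
  IsEquilibrium ρ c n pL pH σ ∧
  ∀ σ' : Fin m → ℝ, IsEquilibrium ρ c n pL pH σ' → ∀ s, σ' s ≤ σ s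

/-- An experiment: `p_L, p_H` are probability mass functions with full joint support,
indexed so that likelihood ratios are nondecreasing. -/
def IsExperiment {m : ℕ} (pL pH : Fin m → ℝ) : Prop :=
  (∀ s, 0 ≤ pL s) ∧ (∀ s, 0 ≤ pH s) ∧
  (∑ s, pL s = 1) ∧ (∑ s, pH s = 1) ∧
  (∀ s, 0 < pL s + pH s) ∧
  (∀ i j : Fin m, i ≤ j → pH i * pL j ≤ pH j * pL i)

/-- A strategy is monotone: a positive acceptance probability at `s_i` forces sure
acceptance at every signal with strictly higher likelihood ratio. -/
def MonotoneStrategy {m : ℕ} (pL pH σ : Fin m → ℝ) : Prop :=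
  ∀ i j : Fin m, 0 < σ i → pH i * pL j < pH j * pL i → σ j = 1

theorem rej_nonneg {m : ℕ} {p σ : Fin m → ℝ} (hp : ∀ s, 0 ≤ p s) (hsum : ∑ s, p s = 1)
    (hσ : IsStrategy σ) : 0 ≤ rej p σ := by
  have h : ∑ s, p s * σ s ≤ ∑ s, p s :=
    Finset.sum_le_sum fun s _ => mul_le_of_le_one_right (hp s) (hσ s).2
  unfold rej
  linarith

theorem visit_nonneg {m : ℕ} {p σ : Fin m → ℝ} (n : ℕ) (hr : 0 ≤ rej p σ) :
    0 ≤ visit n p σ :=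
  mul_nonneg (by positivity) (Finset.sum_nonneg fun k _ => pow_nonneg hr k)

theorem visit_pos {m n : ℕ} {p σ : Fin m → ℝ} (hn : 1 ≤ n) (hr : 0 ≤ rej p σ) :
    0 < visit n p σ := by
  have hn' : (0 : ℝ) < n := by exact_mod_cast hn
  refine mul_pos (by positivity) (Finset.sum_pos' (fun k _ => pow_nonneg hr k) ⟨0, ?_, ?_⟩)
  · exact Finset.mem_range.2 hn
  · simp

theorem interim_pos {m n : ℕ} {ρ : ℝ} {pL pH σ : Fin m → ℝ} (hn : 1 ≤ n)
    (hρ : ρ ∈ Set.Ioo (0 : ℝ) 1) (hE : IsExperiment pL pH) (hσ : IsStrategy σ) :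
    0 < interim ρ n pL pH σ := by
  obtain ⟨hL, hH, hLs, hHs, -, -⟩ := hE
  have h1 := mul_pos hρ.1 (visit_pos hn (rej_nonneg hH hHs hσ))
  have h2 := mul_nonneg (sub_nonneg.2 hρ.2.le) (visit_nonneg n (rej_nonneg hL hLs hσ))
  exact div_pos h1 (by linarith)

/-- An outcome that never occurs under Low quality reveals High quality. -/
theorem post_eq_one {m : ℕ} {ψ : ℝ} {pL pH : Fin m → ℝ} {s : Fin m} (hψ : 0 < ψ)
    (hL : pL s = 0) (hH : 0 < pH s) : post ψ pL pH s = 1 := by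
  have h : ψ * pH s ≠ 0 := (mul_pos hψ hH).ne'
  simp [post, hL, h]

/-- The strategy accepting exactly the outcomes that reveal High quality. -/
def revealing {m : ℕ} (pL : Fin m → ℝ) (s : Fin m) : ℝ := if pL s = 0 then 1 else 0

theorem isStrategy_revealing {m : ℕ} (pL : Fin m → ℝ) : IsStrategy (revealing pL) := by
  intro s
  unfold revealing
  split_ifs <;> norm_num

theorem rej_revealing_low {m : ℕ} (pL : Fin m → ℝ) : rej pL (revealing pL) = 1 := by
  have h : ∑ s, pL s * revealing pL s = 0 :=
    Finset.sum_eq_zero fun s _ => by by_cases hs : pL s = 0 <;> simp [revealing, hs]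
  simp [rej, h]

theorem rej_revealing_high_lt_one {m : ℕ} {pL pH : Fin m → ℝ} (hH : ∀ s, 0 ≤ pH s)
    {t : Fin m} (htL : pL t = 0) (htH : 0 < pH t) : rej pH (revealing pL) < 1 := by
  have h : 0 < ∑ s, pH s * revealing pL s :=
    Finset.sum_pos' (fun s _ => mul_nonneg (hH s) (isStrategy_revealing pL s).1)
      ⟨t, Finset.mem_univ t, by simpa [revealing, htL] using htH⟩
  unfold rej
  linarith

theorem tendsto_visit_zero {m : ℕ} {p σ : Fin m → ℝ} (h0 : 0 ≤ rej p σ) (h1 : rej p σ < 1) :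
    Tendsto (fun n : ℕ => visit n p σ) atTop (𝓝 0) := by
  simpa [visit] using (tendsto_one_div_atTop_nhds_zero_nat (𝕜 := ℝ)).mul
    (hasSum_geometric_of_lt_one h0 h1).tendsto_sum_nat

theorem tendsto_interim_revealing {m : ℕ} {ρ : ℝ} {pL pH : Fin m → ℝ} (hρ : ρ < 1)
    (h0 : 0 ≤ rej pH (revealing pL)) (h1 : rej pH (revealing pL) < 1) :
    Tendsto (fun n : ℕ => interim ρ n pL pH (revealing pL)) atTop (𝓝 0) := by
  have hL : Tendsto (fun n : ℕ => visit n pL (revealing pL)) atTop (𝓝 1) := by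
    refine tendsto_const_nhds.congr' ?_
    filter_upwards [eventually_ne_atTop 0] with n hn
    have hn' : (n : ℝ) ≠ 0 := by exact_mod_cast hn
    simp [visit, rej_revealing_low, hn']
  have hH := (tendsto_visit_zero h0 h1).const_mul ρ
  have h : ρ * 0 + (1 - ρ) * 1 ≠ 0 := by linarith
  simpa [interim, Pi.div_def] using hH.div (hH.add (hL.const_mul (1 - ρ))) h

theorem tendsto_post_zero {m : ℕ} {ψ : ℕ → ℝ} {pL pH : Fin m → ℝ} {s : Fin m}
    (hψ : Tendsto ψ atTop (𝓝 0)) (hs : pL s ≠ 0) :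
    Tendsto (fun n => post (ψ n) pL pH s) atTop (𝓝 0) := by
  have h1 := hψ.mul_const (pH s)
  have h2 := (hψ.const_sub 1).mul_const (pL s)
  simpa [post, Pi.div_def] using h1.div (h1.add h2) (by simpa using hs)

theorem IsEquilibrium.eq_one {m n : ℕ} {ρ c : ℝ} {pL pH σ : Fin m → ℝ} (hn : 1 ≤ n)
    (hρ : ρ ∈ Set.Ioo (0 : ℝ) 1) (hc : c < 1) (hE : IsExperiment pL pH)
    (hσ : IsEquilibrium ρ c n pL pH σ) {s : Fin m} (hs : pL s = 0) : σ s = 1 := by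
  have hH : 0 < pH s := by simpa [hs] using hE.2.2.2.2.1 s
  refine (hσ.2 s).1 ?_
  rwa [post_eq_one (interim_pos hn hρ hE hσ.1) hs hH]

theorem eventually_isEquilibrium_revealing {m : ℕ} {ρ c : ℝ} {pL pH : Fin m → ℝ}
    (hρ : ρ ∈ Set.Ioo (0 : ℝ) 1) (hc : c ∈ Set.Ioo (0 : ℝ) 1) (hE : IsExperiment pL pH)
    {t : Fin m} (htL : pL t = 0) (htH : 0 < pH t) :
    ∀ᶠ n : ℕ in atTop, IsEquilibrium ρ c n pL pH (revealing pL) := by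
  have hψ := tendsto_interim_revealing hρ.2
    (rej_nonneg hE.2.1 hE.2.2.2.1 (isStrategy_revealing pL))
    (rej_revealing_high_lt_one hE.2.1 htL htH)
  have hlt : ∀ᶠ n : ℕ in atTop, ∀ s, pL s ≠ 0 →
      post (interim ρ n pL pH (revealing pL)) pL pH s < c := by
    refine eventually_all.2 fun s => ?_
    by_cases hs : pL s = 0
    · simp [hs]
    · filter_upwards [(tendsto_post_zero hψ hs).eventually_lt_const hc.1] with n hn _ using hn
  filter_upwards [hlt, eventually_ge_atTop 1] with n hn hn1
  refine ⟨isStrategy_revealing pL, fun s => ?_⟩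
  by_cases hs : pL s = 0
  · have hH : 0 < pH s := by simpa [hs] using hE.2.2.2.2.1 s
    rw [post_eq_one (interim_pos hn1 hρ hE (isStrategy_revealing pL)) hs hH]
    exact ⟨fun _ => by simp [revealing, hs], fun h => absurd h hc.2.not_gt⟩
  · exact ⟨fun h => absurd h (hn s hs).not_gt, fun _ => by simp [revealing, hs]⟩

theorem MostSelective.eq_revealing {m n : ℕ} {ρ c : ℝ} {pL pH σ : Fin m → ℝ} (hn : 1 ≤ n)
    (hρ : ρ ∈ Set.Ioo (0 : ℝ) 1) (hc : c < 1) (hE : IsExperiment pL pH)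
    (hσ : MostSelective ρ c n pL pH σ) (hr : IsEquilibrium ρ c n pL pH (revealing pL)) :
    σ = revealing pL := by
  funext s
  by_cases hs : pL s = 0
  · simp [hσ.1.eq_one hn hρ hc hE hs, revealing, hs]
  · have h := hσ.2 _ hr s
    simp only [revealing, hs, if_false] at h ⊢
    exact le_antisymm h (hσ.1.1 s).1

theorem surplus_revealing {m : ℕ} (ρ c : ℝ) (n : ℕ) (pL pH : Fin m → ℝ) :
    surplus ρ c n pL pH (revealing pL) = (1 - c) * ρ * (1 - rej pH (revealing pL) ^ n) := by
  simp [surplus, rej_revealing_low]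

/-- if the top outcome fully reveals High quality, surplus in the most
selective equilibrium is eventually weakly increasing in the number of buyers and
converges to the full-information benchmark `ρ·(1-c)`. -/
theorem more_buyers_unbounded_likelihood
    (ρ c : ℝ) (hρ : ρ ∈ Set.Ioo (0:ℝ) 1) (hc : c ∈ Set.Ioo (0:ℝ) 1)
    (m : ℕ) (hm : 1 ≤ m)
    (pL pH : Fin m → ℝ) (hE : IsExperiment pL pH)
    (htopL : pL ⟨m - 1, by omega⟩ = 0) (htopH : 0 < pH ⟨m - 1, by omega⟩)
    (σhat : ℕ → Fin m → ℝ)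
    (hσ : ∀ k : ℕ, 1 ≤ k → MostSelective ρ c k pL pH (σhat k)) :
    (∃ N : ℕ, ∀ k : ℕ, N ≤ k →
      surplus ρ c k pL pH (σhat k) ≤ surplus ρ c (k + 1) pL pH (σhat (k + 1))) ∧
    Tendsto (fun k : ℕ => surplus ρ c k pL pH (σhat k)) atTop (𝓝 (ρ * (1 - c))) := by
  have h0 := rej_nonneg hE.2.1 hE.2.2.2.1 (isStrategy_revealing pL)
  have h1 := rej_revealing_high_lt_one hE.2.1 htopL htopH
  have hev : ∀ᶠ k : ℕ in atTop, surplus ρ c k pL pH (σhat k) =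
      (1 - c) * ρ * (1 - rej pH (revealing pL) ^ k) := by
    filter_upwards [eventually_isEquilibrium_revealing hρ hc hE htopL htopH,
      eventually_ge_atTop 1] with k hk hk1
    rw [(hσ k hk1).eq_revealing hk1 hρ hc.2 hE hk, surplus_revealing]
  constructor
  · obtain ⟨N, hN⟩ := eventually_atTop.1 hev
    refine ⟨N, fun k hk => ?_⟩
    rw [hN k hk, hN (k + 1) (by omega)]
    have hpow := pow_le_pow_of_le_one h0 h1.le (Nat.le_succ k)
    exact mul_le_mul_of_nonneg_left (sub_le_sub_left hpow 1)
      (mul_nonneg (sub_nonneg.2 hc.2.le) hρ.1.le)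
  · have h := ((tendsto_pow_atTop_nhds_zero_of_lt_one h0 h1).const_sub 1).const_mul ((1 - c) * ρ)
    rw [sub_zero, mul_one, mul_comm (1 - c) ρ] at h
    refine h.congr' ?_
    filter_upwards [hev] with k hk
    rw [hk, mul_comm (1 - c) ρ]
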